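/- There is no real polynomial P of degree 8 that defines the sign pattern (+,+,−,+,−,+,−,−,+), has no negative real roots, and has exactly four positive real roots, each simple. In other words, the sign pattern (+,+,−,+,−,+,−,−,+) is not realizable with the admissible pair (4,0). -/

import Mathlib

open Polynomial

/-- A degree-8 real polynomial `P` defines the sign pattern `σ = (σ_0, …, σ_8)`
(with entries `1` for `+`, `-1` for `−`) if for each `j` the coefficient of
`x^(8-j)` is nonzero and has sign `σ_j`. -/
def definesSignPattern (P : Polynomial ℝ) (σ : Fin 9 → ℝ) : Prop :=
  ∀ j : Fin 9, Real.sign (P.coeff (8 - (j : ℕ))) = σ j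

/-- The elementary symmetric function of degree 2 in four variables. -/
def esymmTwo (y₁ y₂ y₃ y₄ : ℝ) : ℝ :=
  y₁ * y₂ + y₁ * y₃ + y₁ * y₄ + y₂ * y₃ + y₂ * y₄ + y₃ * y₄

/-- The elementary symmetric function of degree 3 in four variables. -/
def esymmThree (y₁ y₂ y₃ y₄ : ℝ) : ℝ :=
  y₁ * y₂ * y₃ + y₁ * y₂ * y₄ + y₁ * y₃ * y₄ + y₂ * y₃ * y₄

set_option maxRecDepth 10000 in
/-- Homogeneous inequalities between the elementary symmetric functions `e`, `b / 9`, `c / 27`,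
`d / 81` of four positive reals. -/
lemma esymm_inequalities {y₁ y₂ y₃ y₄ e b c d : ℝ} (h₁ : 0 < y₁) (h₁₂ : y₁ ≤ y₂) (h₂₃ : y₂ ≤ y₃)
    (h₃₄ : y₃ ≤ y₄) (he : e = y₁ + y₂ + y₃ + y₄) (hb : b = 9 * esymmTwo y₁ y₂ y₃ y₄)
    (hc : c = 27 * esymmThree y₁ y₂ y₃ y₄) (hd : d = 81 * (y₁ * y₂ * y₃ * y₄)) :
    0 ≤ 3 * b * e ^ 3 - c * e ^ 2 - b ^ 2 * e - 2 * d * e + b * c ∧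
    0 ≤ 2 * b * e ^ 2 - 3 * c * e + d ∧
    0 < 9 * b * e ^ 2 - 3 * c * e - b ^ 2 + d ∧
    0 ≤ (9 * b * e ^ 2 - 3 * c * e - b ^ 2 + d) * e ^ 3
      - b * (3 * b * e ^ 3 - c * e ^ 2 - b ^ 2 * e - 2 * d * e + b * c)
      - c * (2 * b * e ^ 2 - 3 * c * e + d) ∧
    0 ≤ 2 * (9 * b * e ^ 2 - 3 * c * e - b ^ 2 + d) * e ^ 4
      - (3 * b * e - c) * (3 * b * e ^ 3 - c * e ^ 2 - b ^ 2 * e - 2 * d * e + b * c)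
      - (3 * c * e - d) * (2 * b * e ^ 2 - 3 * c * e + d) ∧
    0 ≤ 7 * e ^ 2 - b := by
  obtain ⟨u, hu, rfl⟩ : ∃ u, 0 ≤ u ∧ y₂ = y₁ + u := ⟨y₂ - y₁, by linarith, by ring⟩
  obtain ⟨v, hv, rfl⟩ : ∃ v, 0 ≤ v ∧ y₃ = y₁ + u + v := ⟨y₃ - (y₁ + u), by linarith, by ring⟩
  obtain ⟨w, hw, rfl⟩ : ∃ w, 0 ≤ w ∧ y₄ = y₁ + u + v + w :=
    ⟨y₄ - (y₁ + u + v), by linarith, by ring⟩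
  subst he hb hc hd
  unfold esymmTwo esymmThree
  refine ⟨?_, ?_, ?_, ?_, ?_, ?_⟩ <;> ring_nf <;> positivity

/-- The quartic factor `k₀ + k₁ x + … + k₄ x⁴` of a degree 8 polynomial with prescribed coefficient
signs cannot be positive at `1`, if the complementary factor is `∏ (1 + yᵢ x)` with `yᵢ > 0` and
`∑ yᵢ = 3`. -/
lemma cofactor_eval_one_nonpos {y₁ y₂ y₃ y₄ b c d k₀ k₁ k₂ k₃ k₄ : ℝ} (h₁ : 0 < y₁)
    (h₁₂ : y₁ ≤ y₂) (h₂₃ : y₂ ≤ y₃) (h₃₄ : y₃ ≤ y₄) (he : y₁ + y₂ + y₃ + y₄ = 3)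
    (hb : b = esymmTwo y₁ y₂ y₃ y₄) (hc : c = esymmThree y₁ y₂ y₃ y₄)
    (hd : d = y₁ * y₂ * y₃ * y₄)
    (hr₀ : 0 < k₀) (hr₁ : k₁ + 3 * k₀ < 0) (hr₃ : k₃ + 3 * k₂ + b * k₁ + c * k₀ < 0)
    (hr₄ : k₄ + 3 * k₃ + b * k₂ + c * k₁ + d * k₀ < 0) (hr₆ : b * k₄ + c * k₃ + d * k₂ < 0) :
    k₀ + k₁ + k₂ + k₃ + k₄ ≤ 0 := by
  obtain ⟨h3, h4, hδ, h1, h0, h6⟩ := esymm_inequalities (b := 9 * b) (c := 27 * c) (d := 81 * d)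
    h₁ h₁₂ h₂₃ h₃₄ he.symm (by rw [hb]) (by rw [hc]) (by rw [hd])
  have m3 : 0 ≤ 3 * b - c - b ^ 2 - 2 * d + b * c := by linarith
  have m4 : 0 ≤ 2 * b - 3 * c + d := by linarith
  have m6 : 0 ≤ 7 - b := by linarith
  have mδ : 0 < 9 * b - 3 * c - b ^ 2 + d := by linarith
  have m1 : 0 ≤ (9 * b - 3 * c - b ^ 2 + d) - b * (3 * b - c - b ^ 2 - 2 * d + b * c)
      - c * (2 * b - 3 * c + d) := by linarith
  have m0 : 0 ≤ 2 * (9 * b - 3 * c - b ^ 2 + d)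
      - (3 * b - c) * (3 * b - c - b ^ 2 - 2 * d + b * c)
      - (3 * c - d) * (2 * b - 3 * c + d) := by linarith
  have p0 := mul_nonneg m0 hr₀.le
  have p1 := mul_nonpos_of_nonneg_of_nonpos m1 hr₁.le
  have p3 := mul_nonpos_of_nonneg_of_nonpos m3 hr₃.le
  have p4 := mul_nonpos_of_nonneg_of_nonpos m4 hr₄.le
  have p6 := mul_nonpos_of_nonneg_of_nonpos m6 hr₆.le
  refine nonpos_of_mul_nonpos_right (a := 9 * b - 3 * c - b ^ 2 + d) ?_ mδ
  linarith

/-- A root `-1 / y` of a polynomial splits off as a factor `1 + y X`. -/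
lemma exists_eq_one_add_mul {R : ℝ[X]} {y : ℝ} (hy : y ≠ 0) (h : R.eval (-1 / y) = 0) :
    ∃ Q : ℝ[X], R = (1 + C y * X) * Q := by
  obtain ⟨Q, hQ⟩ := dvd_iff_isRoot.2 h
  refine ⟨C y⁻¹ * Q, ?_⟩
  have hC : (C y : ℝ[X]) * C y⁻¹ = 1 := by rw [← C_mul, mul_inv_cancel₀ hy, C_1]
  rw [hQ, show -1 / y = -y⁻¹ by ring, C_neg]
  linear_combination (-X * Q) * hC

/-- Passing to the cofactor of `1 + y X` keeps the roots `-1 / x` with `x ≠ y`. -/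
lemma eval_cofactor_eq_zero {Q : ℝ[X]} {x y : ℝ} (hx : x ≠ 0) (hxy : x ≠ y)
    (h : ((1 + C y * X) * Q).eval (-1 / x) = 0) : Q.eval (-1 / x) = 0 := by
  rw [eval_mul] at h
  refine (mul_eq_zero.1 h).resolve_left fun h0 => hxy ?_
  simp only [eval_add, eval_one, eval_mul, eval_C, eval_X] at h0
  field_simp at h0
  linarith

/-- A polynomial with four distinct roots `-1 / yᵢ` is divisible by `∏ (1 + yᵢ X)`. -/
lemma exists_eq_prod_one_add_mul {R : ℝ[X]} {y₁ y₂ y₃ y₄ : ℝ} (h₁ : 0 < y₁)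
    (h₁₂ : y₁ < y₂) (h₂₃ : y₂ < y₃) (h₃₄ : y₃ < y₄)
    (e₁ : R.eval (-1 / y₁) = 0) (e₂ : R.eval (-1 / y₂) = 0) (e₃ : R.eval (-1 / y₃) = 0)
    (e₄ : R.eval (-1 / y₄) = 0) :
    ∃ K : ℝ[X], R =
      (1 + C y₁ * X) * ((1 + C y₂ * X) * ((1 + C y₃ * X) * ((1 + C y₄ * X) * K))) := by
  have h₂ : 0 < y₂ := h₁.trans h₁₂
  have h₃ : 0 < y₃ := h₂.trans h₂₃
  have h₄ : 0 < y₄ := h₃.trans h₃₄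
  obtain ⟨Q₁, rfl⟩ := exists_eq_one_add_mul h₁.ne' e₁
  replace e₂ := eval_cofactor_eq_zero h₂.ne' h₁₂.ne' e₂
  replace e₃ := eval_cofactor_eq_zero h₃.ne' (h₁₂.trans h₂₃).ne' e₃
  replace e₄ := eval_cofactor_eq_zero h₄.ne' (h₁₂.trans (h₂₃.trans h₃₄)).ne' e₄
  obtain ⟨Q₂, rfl⟩ := exists_eq_one_add_mul h₂.ne' e₂
  replace e₃ := eval_cofactor_eq_zero h₃.ne' h₂₃.ne' e₃
  replace e₄ := eval_cofactor_eq_zero h₄.ne' (h₂₃.trans h₃₄).ne' e₄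
  obtain ⟨Q₃, rfl⟩ := exists_eq_one_add_mul h₃.ne' e₃
  replace e₄ := eval_cofactor_eq_zero h₄.ne' h₃₄.ne' e₄
  obtain ⟨K, rfl⟩ := exists_eq_one_add_mul h₄.ne' e₄
  exact ⟨K, rfl⟩

/-- A polynomial of degree at most 8 with roots `-1 / yᵢ`, where `0 < y₁ < y₂ < y₃ < y₄` and
`∑ yᵢ = 3`, and with prescribed signs of some coefficients, is not positive at `1`. -/
lemma eval_one_nonpos {R : ℝ[X]} (hdeg : R.natDegree ≤ 8) {y₁ y₂ y₃ y₄ : ℝ} (h₁ : 0 < y₁)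
    (h₁₂ : y₁ < y₂) (h₂₃ : y₂ < y₃) (h₃₄ : y₃ < y₄) (he : y₁ + y₂ + y₃ + y₄ = 3)
    (e₁ : R.eval (-1 / y₁) = 0) (e₂ : R.eval (-1 / y₂) = 0) (e₃ : R.eval (-1 / y₃) = 0)
    (e₄ : R.eval (-1 / y₄) = 0) (r₀ : 0 < R.coeff 0) (r₁ : R.coeff 1 < 0)
    (r₃ : R.coeff 3 < 0) (r₄ : R.coeff 4 < 0) (r₆ : R.coeff 6 < 0) : R.eval 1 ≤ 0 := by
  have h₂ : 0 < y₂ := h₁.trans h₁₂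
  have h₃ : 0 < y₃ := h₂.trans h₂₃
  have h₄ : 0 < y₄ := h₃.trans h₃₄
  obtain ⟨K, hK⟩ := exists_eq_prod_one_add_mul h₁ h₁₂ h₂₃ h₃₄ e₁ e₂ e₃ e₄
  have hfac : ∀ y : ℝ, 0 < y → ∀ Q : ℝ[X], Q ≠ 0 →
      (1 + C y * X) * Q ≠ 0 ∧ ((1 + C y * X) * Q).natDegree = 1 + Q.natDegree := by
    intro y hy Q hQ
    have hd : (1 + C y * X : ℝ[X]).natDegree = 1 := by
      rw [add_comm, ← C_1, natDegree_linear hy.ne']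
    have hne : (1 + C y * X : ℝ[X]) ≠ 0 := by
      intro h
      rw [h] at hd
      simp at hd
    exact ⟨mul_ne_zero hne hQ, by rw [natDegree_mul hne hQ, hd]⟩
  have hK0 : K ≠ 0 := by
    rintro rfl
    simp [hK] at r₀
  have hKdeg : K.natDegree ≤ 4 := by
    obtain ⟨n₄, d₄⟩ := hfac y₄ h₄ K hK0
    obtain ⟨n₃, d₃⟩ := hfac y₃ h₃ _ n₄
    obtain ⟨n₂, d₂⟩ := hfac y₂ h₂ _ n₃
    obtain ⟨n₁, d₁⟩ := hfac y₁ h₁ _ n₂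
    rw [hK] at hdeg
    omega
  have hcoeff : ∀ n, 4 < n → K.coeff n = 0 := fun n hn =>
    coeff_eq_zero_of_natDegree_lt (hKdeg.trans_lt hn)
  have hev : K.eval 1 = K.coeff 0 + K.coeff 1 + K.coeff 2 + K.coeff 3 + K.coeff 4 := by
    rw [eval_eq_sum_range' (Nat.lt_succ_of_le hKdeg)]
    simp [Finset.sum_range_succ]
  set b := esymmTwo y₁ y₂ y₃ y₄ with hb
  set c := esymmThree y₁ y₂ y₃ y₄ with hc
  set d := y₁ * y₂ * y₃ * y₄ with hd
  have hR : R = K + C 3 * (K * X) + C b * (K * X ^ 2) + C c * (K * X ^ 3) + C d * (K * X ^ 4) := by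
    rw [hK, ← he, hb, hc, hd, esymmTwo, esymmThree]
    simp only [C_add, C_mul]
    ring
  rw [hR] at r₀ r₁ r₃ r₄ r₆
  simp [coeff_mul_X_pow', coeff_X, coeff_mul_X, hcoeff] at r₀ r₁ r₃ r₄ r₆
  have hK1 : K.eval 1 ≤ 0 := by
    rw [hev]
    exact cofactor_eval_one_nonpos h₁ h₁₂.le h₂₃.le h₃₄.le he hb hc hd r₀ r₁
      (by linarith) (by linarith) (by linarith)
  rw [hK]
  simp only [eval_mul, eval_add, eval_one, eval_C, eval_X, mul_one]
  have hpos : 0 ≤ (1 + y₁) * (1 + y₂) * (1 + y₃) * (1 + y₄) := by positivity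
  have := mul_nonpos_of_nonneg_of_nonpos hpos hK1
  linarith

/-- A real polynomial positive at `0` with no negative roots is positive on the negative
half-line. -/
lemma eval_pos_of_neg {P : ℝ[X]} (h0 : 0 < P.eval 0) (h : ∀ x : ℝ, x < 0 → P.eval x ≠ 0) {x : ℝ}
    (hx : x < 0) : 0 < P.eval x := by
  by_contra! hneg
  obtain ⟨t, ht, ht0⟩ := intermediate_value_Icc hx.le P.continuous.continuousOn ⟨hneg, h0.le⟩
  rcases ht.2.lt_or_eq with hlt | rfl
  · exact h t hlt ht0
  · exact h0.ne' ht0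

lemma pos_of_real_sign_eq_one {a : ℝ} (h : Real.sign a = 1) : 0 < a := by
  rcases lt_trichotomy a 0 with ha | rfl | ha
  · rw [Real.sign_of_neg ha] at h
    norm_num at h
  · simp at h
  · exact ha

lemma neg_of_real_sign_eq_neg_one {a : ℝ} (h : Real.sign a = -1) : a < 0 := by
  rcases lt_trichotomy a 0 with ha | rfl | ha
  · exact ha
  · simp at h
  · rw [Real.sign_of_pos ha] at h
    norm_num at h

/-- The given sign pattern is not realizable with the admissible pair (4,0):
there is no degree 8 real polynomial defining this pattern, with no negative
real roots and exactly four positive real roots, each simple. -/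
theorem stmt2 :
    ¬ ∃ P : Polynomial ℝ, P.degree = 8 ∧
      definesSignPattern P ![1, 1, -1, 1, -1, 1, -1, -1, 1] ∧
      (∀ x : ℝ, x < 0 → P.eval x ≠ 0) ∧
      ∃ z : Fin 4 → ℝ, StrictMono z ∧ (∀ i, 0 < z i) ∧
        (∀ i, P.eval (z i) = 0) ∧ (∀ i, P.rootMultiplicity (z i) = 1) ∧
        (∀ x : ℝ, 0 < x → P.eval x = 0 → ∃ i, x = z i) := by
  rintro ⟨P, hdeg, hsign, hneg, z, hz, hzpos, hroot, -, -⟩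
  have hnat : P.natDegree = 8 := natDegree_eq_of_degree_eq_some hdeg
  have p₀ : 0 < P.coeff 0 := pos_of_real_sign_eq_one (by simpa using hsign 8)
  have p₈ : 0 < P.coeff 8 := pos_of_real_sign_eq_one (by simpa using hsign 0)
  have p₇ : 0 < P.coeff 7 := pos_of_real_sign_eq_one (by simpa using hsign 1)
  have p₅ : 0 < P.coeff 5 := pos_of_real_sign_eq_one (by simpa using hsign 3)
  have p₄ : P.coeff 4 < 0 := neg_of_real_sign_eq_neg_one (by simpa using hsign 4)
  have p₂ : P.coeff 2 < 0 := neg_of_real_sign_eq_neg_one (by simpa using hsign 6)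
  obtain ⟨w, hw, hsum⟩ : ∃ w : ℝ, 0 < w ∧ w * z 0 + w * z 1 + w * z 2 + w * z 3 = 3 := by
    have hS : 0 < z 0 + z 1 + z 2 + z 3 := by linarith [hzpos 0, hzpos 1, hzpos 2, hzpos 3]
    refine ⟨3 / (z 0 + z 1 + z 2 + z 3), by positivity, ?_⟩
    field_simp
  have hrev : ∀ x : ℝ, x ≠ 0 → P.reverse.eval x⁻¹ * x ^ 8 = P.eval x := by
    intro x hx
    have : Invertible x := invertibleOfNonzero hx
    have h := eval₂_reverse_mul_pow (RingHom.id ℝ) x P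
    rwa [hnat, invOf_eq_inv] at h
  set R : ℝ[X] := P.reverse.comp (C (-w) * X) with hR
  have hcoeff : ∀ n, n ≤ 8 → R.coeff n = P.coeff (8 - n) * (-w) ^ n := by
    intro n hn
    rw [hR, comp_C_mul_X_coeff, coeff_reverse, hnat, revAt_le hn]
  have hRdeg : R.natDegree ≤ 8 := by
    refine natDegree_comp_le.trans ?_
    calc P.reverse.natDegree * (C (-w) * X : ℝ[X]).natDegree ≤ 8 * 1 :=
          Nat.mul_le_mul (hnat ▸ reverse_natDegree_le P) ((natDegree_C_mul_le _ _).trans_eq natDegree_X)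
      _ = 8 := rfl
  have hRroot : ∀ i, R.eval (-1 / (w * z i)) = 0 := by
    intro i
    have hzi := hzpos i
    have h := hrev (z i) hzi.ne'
    rw [hroot i] at h
    have harg : -w * (-1 / (w * z i)) = (z i)⁻¹ := by field_simp
    rw [hR, eval_comp, eval_mul, eval_C, eval_X, harg]
    exact (mul_eq_zero.1 h).resolve_right (pow_pos hzi 8).ne'
  have hmono : ∀ i j : Fin 4, i < j → w * z i < w * z j := fun i j hij =>
    mul_lt_mul_of_pos_left (hz hij) hw
  have hle : R.eval 1 ≤ 0 := by
    refine eval_one_nonpos hRdeg (mul_pos hw (hzpos 0)) (hmono 0 1 (by decide))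
      (hmono 1 2 (by decide)) (hmono 2 3 (by decide)) hsum (hRroot 0) (hRroot 1) (hRroot 2)
      (hRroot 3) ?_ ?_ ?_ ?_ ?_
    · rw [hcoeff 0 (by norm_num)]
      simpa using p₈
    · rw [hcoeff 1 (by norm_num)]
      exact mul_neg_of_pos_of_neg p₇ (Odd.pow_neg (by decide) (neg_lt_zero.2 hw))
    · rw [hcoeff 3 (by norm_num)]
      exact mul_neg_of_pos_of_neg p₅ (Odd.pow_neg (by decide) (neg_lt_zero.2 hw))
    · rw [hcoeff 4 (by norm_num)]
      exact mul_neg_of_neg_of_pos p₄ (Even.pow_pos (by decide) (neg_ne_zero.2 hw.ne'))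
    · rw [hcoeff 6 (by norm_num)]
      exact mul_neg_of_neg_of_pos p₂ (Even.pow_pos (by decide) (neg_ne_zero.2 hw.ne'))
  have hwneg : (-w)⁻¹ < 0 := inv_lt_zero.2 (neg_lt_zero.2 hw)
  have hpos : 0 < P.eval (-w)⁻¹ :=
    eval_pos_of_neg (by rwa [← coeff_zero_eq_eval_zero]) hneg hwneg
  rw [← hrev _ hwneg.ne, inv_inv] at hpos
  have hR1 : R.eval 1 = P.reverse.eval (-w) := by simp [hR, eval_comp]
  rw [hR1] at hle
  exact hpos.not_ge (mul_nonpos_of_nonpos_of_nonneg hle (Even.pow_nonneg (by decide) _))
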